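/- Let R be an almost perfect domain with Q ≠ R. If an R-module M has finite flat (weak) dimension, then its flat dimension is at most 1. -/

import Mathlib

universe u

/-- `f : P →ₗ[R] M` is a projective cover of `M`. -/
def IsProjectiveCover (R : Type u) [CommRing R] {P M : Type u}
    [AddCommGroup P] [Module R P] [AddCommGroup M] [Module R M] (f : P →ₗ[R] M) : Prop :=
  Module.Projective R P ∧ Function.Surjective f ∧
    ∀ N : Submodule R P, N ⊔ LinearMap.ker f = ⊤ → N = ⊤

/-- A commutative ring is perfect iff every module has a projective cover. -/
def IsPerfectRing (R : Type u) [CommRing R] : Prop :=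
  ∀ (M : Type u) (_ : AddCommGroup M) (_ : Module R M),
    ∃ (P : Type u) (_ : AddCommGroup P) (_ : Module R P) (f : P →ₗ[R] M),
      IsProjectiveCover R f

/-- An almost perfect domain: an integral domain such that every proper quotient is perfect. -/
def IsAPD (R : Type u) [CommRing R] [IsDomain R] : Prop :=
  ∀ I : Ideal R, I ≠ ⊥ → IsPerfectRing (R ⧸ I)
open CategoryTheory Limits

/-- `InjDimLE R n M` : the injective dimension of `M` is at most `n`. -/
def InjDimLE (R : Type u) [CommRing R] : ℕ → ModuleCat.{u} R → Prop
  | 0, M => Injective M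
  | n + 1, M => ∃ (E : ModuleCat.{u} R) (f : M ⟶ E),
      Mono f ∧ Injective E ∧ InjDimLE R n (cokernel f)

/-- `ProjDimLE R n M` : the projective dimension of `M` is at most `n`. -/
def ProjDimLE (R : Type u) [CommRing R] : ℕ → ModuleCat.{u} R → Prop
  | 0, M => Projective M
  | n + 1, M => ∃ (P : ModuleCat.{u} R) (f : P ⟶ M),
      Epi f ∧ Projective P ∧ ProjDimLE R n (kernel f)

/-- `FlatDimLE R n M` : the flat (weak) dimension of `M` is at most `n`. -/
def FlatDimLE (R : Type u) [CommRing R] : ℕ → ModuleCat.{u} R → Prop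
  | 0, M => Module.Flat R M
  | n + 1, M => ∃ (P : ModuleCat.{u} R) (f : P ⟶ M),
      Epi f ∧ Module.Flat R P ∧ FlatDimLE R n (kernel f)

/-- An `R`-module is divisible if `rM = M` for every nonzero `r : R`. -/
def IsDivisibleModule (R : Type u) [CommRing R] (M : Type u) [AddCommGroup M] [Module R M] :
    Prop :=
  ∀ r : R, r ≠ 0 → ∀ m : M, ∃ x : M, r • x = m

section PerfectRing

variable {S : Type u} [CommRing S]

theorem apd_proj_eq_zero {P : Type u} [AddCommGroup P] [Module S P] [Module.Projective S P]
    (h : (⊤ : Submodule S P) ≤ (Ideal.jacobson (⊥ : Ideal S)) • ⊤) (x : P) : x = 0 := by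
  obtain ⟨s, hs⟩ := (Module.Projective.out : ∃ s : P →ₗ[S] P →₀ S, _)
  have hJ : ∀ q p : P, s q p ∈ Ideal.jacobson (⊥ : Ideal S) := by
    intro q p
    have hq : q ∈ (Ideal.jacobson (⊥ : Ideal S)) • (⊤ : Submodule S P) := h trivial
    have h2 := Submodule.mem_map_of_mem (f := (Finsupp.lapply p).comp s) hq
    rw [Submodule.map_smul''] at h2
    rw [Ideal.smul_eq_mul] at h2
    have h3 : s q p ∈ Ideal.jacobson (⊥ : Ideal S) * _ := h2
    exact (Ideal.mul_le_inf.trans inf_le_left) h3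
  let A : Ideal S := Ideal.span (Set.range fun p : (s x).support => s x p)
  have hmem : ∀ p, s x p ∈ A := by
    intro p
    by_cases hp : p ∈ (s x).support
    · exact Ideal.subset_span ⟨⟨p, hp⟩, rfl⟩
    · rw [Finsupp.notMem_support_iff.mp hp]; exact zero_mem _
  have hx : (s x).sum (fun q c => c • q) = x := by
    have := hs x
    simpa [Finsupp.linearCombination_apply] using this
  have hA : A = ⊥ := by
    apply Submodule.eq_bot_of_le_smul_of_le_jacobson_bot (Ideal.jacobson ⊥) A _ _ le_rfl
    · exact Submodule.fg_span (Set.finite_range _)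
    · refine Ideal.span_le.mpr ?_
      rintro _ ⟨p, rfl⟩
      have : s x p = (s x).sum (fun q c => c * s q p) := by
        have h3 := congrArg (fun y => s y p) hx
        simp only [Finsupp.sum, map_sum, Finsupp.finsetSum_apply, map_smul, Finsupp.smul_apply,
          smul_eq_mul] at h3
        exact h3.symm
      simp only [SetLike.mem_coe]
      rw [this]
      refine Submodule.sum_mem _ fun q _ => ?_
      change s x q * s q p ∈ _
      rw [mul_comm]
      exact Submodule.smul_mem_smul (hJ q p) (hmem q)
  rw [← hx]
  refine Finset.sum_eq_zero fun q _ => ?_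
  have := hmem q
  rw [hA, Ideal.mem_bot] at this
  simp [this]

theorem apd_cover_ker {P M : Type u} [AddCommGroup P] [Module S P] [AddCommGroup M] [Module S M]
    {f : P →ₗ[S] M} (hf : IsProjectiveCover S f) (g : P →ₗ[S] S) (k : P) (hk : f k = 0) :
    g k ∈ Ideal.jacobson (⊥ : Ideal S) := by
  rw [Ideal.jacobson, Ideal.mem_sInf]
  rintro m ⟨-, hm⟩
  by_contra hgk
  have hN : Submodule.comap g m = (⊤ : Submodule S P) := by
    apply hf.2.2
    rw [eq_top_iff]
    intro p _
    obtain ⟨c, hc⟩ := hm.exists_inv hgk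
    obtain ⟨i, hi, hci⟩ := hc
    rw [Submodule.mem_sup]
    refine ⟨p - (g p * c) • k, ?_, (g p * c) • k, ?_, by simp⟩
    · simp only [Submodule.mem_comap, map_sub, map_smul, smul_eq_mul]
      have : g p - g p * c * g k = g p * i := by linear_combination - g p * hci
      rw [this]
      exact m.mul_mem_left _ hi
    · simp [hk]
  have : k ∈ Submodule.comap g m := by rw [hN]; trivial
  exact hgk this

theorem apd_subsingleton (hS : IsPerfectRing S) {M : Type u} [AddCommGroup M] [Module S M]
    (h : (⊤ : Submodule S M) ≤ (Ideal.jacobson (⊥ : Ideal S)) • ⊤) (x : M) : x = 0 := by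
  obtain ⟨P, _, _, f, hP, hsurj, hsup⟩ := hS M inferInstance inferInstance
  obtain ⟨p, rfl⟩ := hsurj x
  have : (Ideal.jacobson (⊥ : Ideal S)) • (⊤ : Submodule S P) = ⊤ := by
    apply hsup
    rw [eq_top_iff]
    intro p _
    have hp : f p ∈ (Ideal.jacobson (⊥ : Ideal S)) • (⊤ : Submodule S M) := h trivial
    rw [← LinearMap.range_eq_top.mpr hsurj, LinearMap.range_eq_map, ← Submodule.map_smul''] at hp
    obtain ⟨q, hq, hqp⟩ := hp
    rw [Submodule.mem_sup]
    exact ⟨q, hq, p - q, by simp [hqp], by simp⟩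
  rw [apd_proj_eq_zero this.ge p, map_zero]

def apdEvZero (S : Type u) [CommRing S] : Submodule S (ℕ → S) where
  carrier := {f | ∃ N, ∀ n, N ≤ n → f n = 0}
  zero_mem' := ⟨0, fun _ _ => rfl⟩
  add_mem' := by
    rintro f g ⟨N, hN⟩ ⟨K, hK⟩
    refine ⟨max N K, fun n hn => ?_⟩
    simp [hN n (le_trans (le_max_left _ _) hn), hK n (le_trans (le_max_right _ _) hn)]
  smul_mem' := by
    rintro c f ⟨N, hN⟩
    exact ⟨N, fun n hn => by simp [hN n hn]⟩

theorem apd_tnilp (hS : IsPerfectRing S) (a : ℕ → S)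
    (ha : ∀ n, a n ∈ Ideal.jacobson (⊥ : Ideal S)) : ∃ n, ∏ i ∈ Finset.range n, a i = 0 := by
  let e : ℕ → (ℕ → S) ⧸ apdEvZero S := fun n =>
    (apdEvZero S).mkQ (fun k => ∏ i ∈ Finset.Ico n k, a i)
  have he : ∀ n, e n = a n • e (n + 1) := by
    intro n
    simp only [e, ← map_smul]
    rw [← sub_eq_zero, ← map_sub, Submodule.mkQ_apply, Submodule.Quotient.mk_eq_zero]
    refine ⟨n + 1, fun k hk => ?_⟩
    simp only [Pi.sub_apply, Pi.smul_apply, smul_eq_mul]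
    rw [Finset.prod_eq_prod_Ico_succ_bot (by omega), sub_self]
  let E := Submodule.span S (Set.range e)
  have h0 : (⟨e 0, Submodule.subset_span ⟨0, rfl⟩⟩ : E) = 0 := by
    apply apd_subsingleton hS
    have h1 : ∀ n, (⟨e n, Submodule.subset_span ⟨n, rfl⟩⟩ : E) ∈
        (Ideal.jacobson (⊥ : Ideal S)) • (⊤ : Submodule S E) := by
      intro n
      have : (⟨e n, Submodule.subset_span ⟨n, rfl⟩⟩ : E) =
        a n • ⟨e (n+1), Submodule.subset_span ⟨n+1, rfl⟩⟩ := Subtype.ext (he n)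
      rw [this]
      exact Submodule.smul_mem_smul (ha n) trivial
    rintro ⟨x, hx⟩ _
    induction hx using Submodule.span_induction with
    | mem x hx => obtain ⟨n, rfl⟩ := hx; exact h1 n
    | zero => exact zero_mem _
    | add x y hx hy h1 h2 => exact add_mem (h1 trivial) (h2 trivial)
    | smul c x hx h => exact Submodule.smul_mem _ c (h trivial)
  have h2 : e 0 = 0 := congrArg Subtype.val h0
  have h2 := (Submodule.Quotient.mk_eq_zero (apdEvZero S)).1 h2
  obtain ⟨N, hN⟩ := h2
  refine ⟨N, ?_⟩
  rw [Finset.range_eq_Ico]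
  exact hN N le_rfl

theorem apd_socle (hS : IsPerfectRing S) (x : S) (hx : x ≠ 0) :
    ∃ z, z * x ≠ 0 ∧ ∀ a ∈ Ideal.jacobson (⊥ : Ideal S), a * (z * x) = 0 := by
  by_contra! hcon
  choose! a ha using hcon
  let w : ℕ → S := fun n => Nat.rec 1 (fun _ w => a w * w) n
  have hw0 : w 0 = 1 := rfl
  have hws : ∀ n, w (n + 1) = a (w n) * w n := fun _ => rfl
  have hw : ∀ n, w n * x ≠ 0 := by
    intro n
    induction n with
    | zero => simpa [hw0] using hx
    | succ n ih => rw [hws, mul_assoc]; exact (ha _ ih).2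
  have hp : ∀ n, ∏ i ∈ Finset.range n, a (w i) = w n := by
    intro n
    induction n with
    | zero => simp [hw0]
    | succ n ih => rw [Finset.prod_range_succ, ih, hws, mul_comm]
  obtain ⟨n, hn⟩ := apd_tnilp hS (fun n => a (w n)) (fun n => (ha _ (hw n)).1)
  rw [hp] at hn
  exact hw n (by simp [hn])

theorem apd_key (hS : IsPerfectRing S) (m : Ideal S) [hm : m.IsMaximal] :
    ∃ y : S, y ≠ 0 ∧ ∀ t ∈ m, t * y = 0 := by
  obtain ⟨P, _, _, f, hf⟩ := hS (S ⧸ m) inferInstance inferInstance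
  have := hf.1
  obtain ⟨g, hg⟩ := Module.projective_lifting_property m.mkQ f (Submodule.mkQ_surjective m)
  obtain ⟨p, hp⟩ := hf.2.1 (m.mkQ 1)
  obtain ⟨e, rfl⟩ : ∃ e, e = g p := ⟨_, rfl⟩
  have he1 : m.mkQ (g p) = m.mkQ 1 := by rw [← hp, ← hg]; rfl
  have heJ : ∀ t ∈ m, t * g p ∈ Ideal.jacobson (⊥ : Ideal S) := by
    intro t ht
    have := apd_cover_ker hf g (t • p) (by
      rw [map_smul, hp, ← map_smul, Submodule.mkQ_apply, Submodule.Quotient.mk_eq_zero]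
      simpa using ht)
    simpa using this
  generalize g p = e at he1 heJ
  have hu : 1 - e ∈ m := by
    rw [← Submodule.Quotient.mk_eq_zero m, ← Submodule.mkQ_apply, map_sub, he1, sub_self]
  have hem : e ∉ m := fun h => hm.ne_top ((Ideal.eq_top_iff_one _).2 (by
    simpa using m.add_mem hu h))
  obtain ⟨k, hk⟩ := apd_tnilp hS (fun _ => (1 - e) * e) (fun _ => heJ _ hu)
  rw [Finset.prod_const, Finset.card_range, mul_pow] at hk
  have hek : e ^ k ≠ 0 := fun h => hem (hm.isPrime.mem_of_pow_mem k (by rw [h]; exact zero_mem _))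
  obtain ⟨z, hz, hzJ⟩ := apd_socle hS _ hek
  refine ⟨e * (z * e ^ k), ?_, ?_⟩
  · intro h0
    apply hz
    have hd : e ∣ 1 - (1 - e) ^ k := by
      have := sub_dvd_pow_sub_pow 1 (1 - e) k
      simpa using this
    obtain ⟨d, hd⟩ := hd
    linear_combination d * h0 + z * hk + z * e ^ k * hd
  · intro t ht
    rw [← mul_assoc]
    exact hzJ _ (heJ t ht)

end PerfectRing
section TorVanishing

open TensorProduct

variable {R : Type u} [CommRing R] {F₁ F₀ : Type u} [AddCommGroup F₁] [Module R F₁]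
  [AddCommGroup F₀] [Module R F₀]

theorem apd_comm (i : F₁ →ₗ[R] F₀) {A B : Type u} [AddCommGroup A] [Module R A]
    [AddCommGroup B] [Module R B] (f : A →ₗ[R] B) (x : F₁ ⊗[R] A) :
    i.rTensor B (f.lTensor F₁ x) = f.lTensor F₀ (i.rTensor A x) := by
  rw [← LinearMap.comp_apply, ← LinearMap.comp_apply, LinearMap.rTensor_comp_lTensor,
    LinearMap.lTensor_comp_rTensor]

theorem apd_T_sub [Module.Flat R F₁] (i : F₁ →ₗ[R] F₀) {A B : Type u} [AddCommGroup A] [Module R A]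
    [AddCommGroup B] [Module R B] (f : A →ₗ[R] B) (hf : Function.Injective f)
    (hB : Function.Injective (i.rTensor B)) : Function.Injective (i.rTensor A) := by
  rw [injective_iff_map_eq_zero]
  intro x hx
  apply Module.Flat.lTensor_preserves_injective_linearMap (M := F₁) f hf
  apply hB
  rw [apd_comm, hx]
  simp

theorem apd_T_ext [Module.Flat R F₁] [Module.Flat R F₀] (i : F₁ →ₗ[R] F₀) {A B C : Type u}
    [AddCommGroup A] [Module R A]
    [AddCommGroup B] [Module R B] [AddCommGroup C] [Module R C] (f : A →ₗ[R] B) (g : B →ₗ[R] C)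
    (hf : Function.Injective f) (hfg : Function.Exact f g)
    (hA : Function.Injective (i.rTensor A)) (hC : Function.Injective (i.rTensor C)) :
    Function.Injective (i.rTensor B) := by
  rw [injective_iff_map_eq_zero]
  intro x hx
  have h1 : g.lTensor F₁ x = 0 := by
    apply hC
    rw [apd_comm, hx]
    simp
  obtain ⟨y, rfl⟩ := (Module.Flat.lTensor_exact F₁ hfg x).1 h1
  have h2 : y = 0 := by
    apply hA
    apply Module.Flat.lTensor_preserves_injective_linearMap (M := F₀) f hf
    rw [← apd_comm, hx]
    simp
  rw [h2, map_zero]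

theorem apd_T_principal {K : Type u} [AddCommGroup K] [Module R K]
    (i : F₁ →ₗ[R] F₀) (π : F₀ →ₗ[R] K) (hi : Function.Injective i)
    (hex : Function.Exact i π) (r : R) (hr : ∀ k : K, r • k = 0 → k = 0) :
    Function.Injective (i.rTensor (R ⧸ Ideal.span {r})) := by
  let μ : R →ₗ[R] R := LinearMap.lsmul R R r
  have hμ : Function.Exact μ (Ideal.span {r}).mkQ := by
    intro x
    rw [Submodule.mkQ_apply, Submodule.Quotient.mk_eq_zero, Ideal.mem_span_singleton']
    constructor
    · rintro ⟨a, rfl⟩; exact ⟨a, by simp [μ, mul_comm]⟩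
    · rintro ⟨a, rfl⟩; exact ⟨a, by simp [μ, mul_comm]⟩
  have hsurj := Submodule.mkQ_surjective (Ideal.span {r})
  have hrep : ∀ {F : Type u} [AddCommGroup F] [Module R F] (z : F ⊗[R] R), ∃ f : F, z = f ⊗ₜ 1 :=
    fun z => ⟨TensorProduct.rid R _ z, by
      rw [← TensorProduct.rid_symm_apply, LinearEquiv.symm_apply_apply]⟩
  rw [injective_iff_map_eq_zero]
  intro x hx
  obtain ⟨y, rfl⟩ := LinearMap.lTensor_surjective F₁ hsurj x
  obtain ⟨f, rfl⟩ := hrep y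
  rw [apd_comm] at hx
  obtain ⟨z, hz⟩ := (lTensor_exact F₀ hμ hsurj _).1 hx
  obtain ⟨g, rfl⟩ := hrep z
  have hz' := congrArg (TensorProduct.rid R F₀) hz
  simp only [LinearMap.lTensor_tmul, LinearMap.rTensor_tmul, TensorProduct.rid_tmul, μ,
    LinearMap.lsmul_apply, smul_eq_mul, mul_one, one_smul] at hz'
  have hg : π g = 0 := by
    apply hr
    rw [← map_smul, hz']
    exact (hex _).2 ⟨f, rfl⟩
  obtain ⟨g', rfl⟩ := (hex _).1 hg
  have hf : f = r • g' := hi (by rw [map_smul, hz'])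
  refine (lTensor_exact F₁ hμ hsurj _).2 ⟨g' ⊗ₜ 1, ?_⟩
  rw [LinearMap.lTensor_tmul, hf, TensorProduct.smul_tmul]
  simp [μ]

theorem apd_flat_of_T {K : Type u} [AddCommGroup K] [Module R K] [Module.Flat R F₀]
    (i : F₁ →ₗ[R] F₀) (π : F₀ →ₗ[R] K) (hπ : Function.Surjective π)
    (hex : Function.Exact i π)
    (hT : ∀ I : Ideal R, Function.Injective (i.rTensor (R ⧸ I))) : Module.Flat R K := by
  rw [Module.Flat.iff_lTensor_injective']
  intro I
  rw [injective_iff_map_eq_zero]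
  intro k hk
  obtain ⟨f, rfl⟩ := LinearMap.rTensor_surjective I hπ k
  rw [← apd_comm] at hk
  obtain ⟨g, hg⟩ := (rTensor_exact R hex hπ _).1 hk
  have hIex : Function.Exact I.subtype I.mkQ := LinearMap.exact_subtype_mkQ I
  have h1 : I.mkQ.lTensor F₁ g = 0 := by
    apply hT I
    rw [apd_comm, hg, map_zero]
    exact (lTensor_exact F₀ hIex (Submodule.mkQ_surjective I)).apply_apply_eq_zero f
  obtain ⟨h, rfl⟩ := (lTensor_exact F₁ hIex (Submodule.mkQ_surjective I) _).1 h1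
  rw [apd_comm] at hg
  have h2 := Module.Flat.lTensor_preserves_injective_linearMap (M := F₀) I.subtype
    I.subtype_injective hg
  rw [← h2]
  exact (rTensor_exact I hex hπ).apply_apply_eq_zero h

theorem apd_T_chain [Module.Flat R F₀] (i : F₁ →ₗ[R] F₀) {N : Type u} [AddCommGroup N] [Module R N]
    (c : Set (Submodule R N)) (hc : IsChain (· ≤ ·) c) (hne : c.Nonempty)
    (hT : ∀ A ∈ c, Function.Injective (i.rTensor A)) :
    Function.Injective (i.rTensor (sSup c : Submodule R N)) := by
  rw [injective_iff_map_eq_zero]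
  intro x hx
  obtain ⟨M', N', -, hfg, hle⟩ := TensorProduct.exists_finite_submodule_of_setFinite {x}
    (Set.finite_singleton x)
  have hfg' : (N'.map (sSup c).subtype).FG := (Module.Finite.iff_fg.mp hfg).map _
  obtain ⟨A, hA, hNA⟩ : ∃ A ∈ c, N'.map (sSup c).subtype ≤ A := by
    exact (Submodule.fg_iff_compact _).1 hfg' c (sSup c) hne hc.directedOn (isLUB_sSup c)
      (Submodule.map_subtype_le _ _)
  let ι : A →ₗ[R] (sSup c : Submodule R N) := Submodule.inclusion (le_sSup hA)
  let κ : N' →ₗ[R] A := LinearMap.codRestrict A ((sSup c).subtype ∘ₗ N'.subtype)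
    (fun n => hNA ⟨n.1, n.2, rfl⟩)
  have hικ : ι ∘ₗ κ = N'.subtype := by ext n; rfl
  obtain ⟨z, hz⟩ := hle (Set.mem_singleton x)
  obtain ⟨y, rfl⟩ : ∃ y : F₁ ⊗[R] A, ι.lTensor F₁ y = x := by
    refine ⟨TensorProduct.map M'.subtype κ z, ?_⟩
    rw [← hz, TensorProduct.mapIncl, ← hικ, ← LinearMap.comp_apply, LinearMap.lTensor_comp_map]
  have : y = 0 := by
    apply hT A hA
    apply Module.Flat.lTensor_preserves_injective_linearMap (M := F₀) ι
      (Submodule.inclusion_injective _)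
    rw [← apd_comm, hx]
    simp
  rw [this, map_zero]

theorem apd_quot_key [IsDomain R] (hR : IsAPD R) (I : Ideal R) (hI : I ≠ ⊥) (m : Ideal R)
    [hm : m.IsMaximal] (hIm : I ≤ m) : ∃ y : R, y ∉ I ∧ ∀ t ∈ m, t * y ∈ I := by
  have hmax : (m.map (Ideal.Quotient.mk I)).IsMaximal :=
    Ideal.IsMaximal.map_of_surjective_of_ker_le Ideal.Quotient.mk_surjective (by simpa using hIm)
  obtain ⟨y, hy, hy2⟩ := apd_key (hR I hI) (m.map (Ideal.Quotient.mk I))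
  obtain ⟨y, rfl⟩ := Ideal.Quotient.mk_surjective y
  refine ⟨y, fun h => hy (Ideal.Quotient.eq_zero_iff_mem.2 h), fun t ht => ?_⟩
  have := hy2 _ (Ideal.mem_map_of_mem (Ideal.Quotient.mk I) ht)
  rwa [← map_mul, Ideal.Quotient.eq_zero_iff_mem] at this

theorem apd_torsionOf {N : Type u} [AddCommGroup N] [Module R N] (m : Ideal R)
    [hm : m.IsMaximal] (x : N) (hx : x ≠ 0) (h : ∀ t ∈ m, t • x = 0) :
    Ideal.torsionOf R N x = m := by
  symm
  apply hm.eq_of_le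
  · rw [Ne, Ideal.eq_top_iff_one, Ideal.mem_torsionOf_iff, one_smul]; exact hx
  · intro t ht; exact (Ideal.mem_torsionOf_iff x t).2 (h t ht)

theorem apd_flat_of_torsionFree [IsDomain R] (hR : IsAPD R) (hQ : ¬ IsField R)
    {K : Type u} [AddCommGroup K] [Module R K] [Module.Flat R F₀] [Module.Flat R F₁]
    (i : F₁ →ₗ[R] F₀) (π : F₀ →ₗ[R] K) (hi : Function.Injective i) (hπ : Function.Surjective π)
    (hex : Function.Exact i π) (htf : ∀ (r : R) (k : K), r ≠ 0 → r • k = 0 → k = 0) :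
    Module.Flat R K := by
  have hsimple : ∀ m : Ideal R, m.IsMaximal → Function.Injective (i.rTensor (R ⧸ m)) := by
    intro m hm
    have hm0 : m ≠ ⊥ := Ring.ne_bot_of_isMaximal_of_not_isField hm hQ
    obtain ⟨r, hrm, hr0⟩ := Submodule.exists_mem_ne_zero_of_ne_bot hm0
    obtain ⟨y, hy, hym⟩ := apd_quot_key hR (Ideal.span {r}) (by simpa using hr0) m
      (by rwa [Ideal.span_le, Set.singleton_subset_iff])
    have htor := apd_torsionOf m ((Ideal.span {r}).mkQ y)
      (by rwa [Ne, Submodule.mkQ_apply, Submodule.Quotient.mk_eq_zero])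
      (fun t ht => by
        rw [← map_smul, Submodule.mkQ_apply, Submodule.Quotient.mk_eq_zero]; exact hym t ht)
    have e := Ideal.quotTorsionOfEquivSpanSingleton R _ ((Ideal.span {r}).mkQ y)
    rw [htor] at e
    exact apd_T_sub i ((Submodule.subtype _) ∘ₗ e.toLinearMap)
      ((Submodule.subtype_injective _).comp e.injective)
      (apd_T_principal i π hi hex r (fun k => htf r k hr0))
  apply apd_flat_of_T i π hπ hex
  intro I
  by_cases hI : I = ⊥
  · subst hI
    have := apd_T_principal i π hi hex 0
    refine apd_T_sub i (Submodule.quotEquivOfEqBot (⊥ : Ideal R) rfl).toLinearMap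
      (LinearEquiv.injective _) ?_
    exact Module.Flat.rTensor_preserves_injective_linearMap i hi
  obtain ⟨A, -, hA⟩ := zorn_le_nonempty₀
    {A : Submodule R (R ⧸ I) | Function.Injective (i.rTensor A)}
    (fun c hcs hc y hy => ⟨sSup c, apd_T_chain i c hc ⟨y, hy⟩ (fun A h => hcs h),
      fun z hz => le_sSup hz⟩)
    ⊥ (by
      have : Subsingleton (F₁ ⊗[R] (⊥ : Submodule R (R ⧸ I))) := inferInstance
      exact Function.injective_of_subsingleton _)
  have hAT : Function.Injective (i.rTensor A) := hA.prop
  by_cases htop : A = ⊤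
  · subst htop
    exact apd_T_sub i (Submodule.topEquiv (R := R) (M := R ⧸ I)).symm.toLinearMap
      (LinearEquiv.injective _) hAT
  exfalso
  let L : Ideal R := Submodule.comap I.mkQ A
  have hIL : I ≤ L := by
    intro x hx
    change I.mkQ x ∈ A
    rw [Submodule.mkQ_apply, (Submodule.Quotient.mk_eq_zero I).2 hx]
    exact zero_mem _
  have hL : L ≠ ⊤ := by
    intro h
    apply htop
    rw [eq_top_iff]
    rintro x -
    obtain ⟨x, rfl⟩ := Submodule.mkQ_surjective I x
    have : x ∈ L := by rw [h]; trivial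
    exact this
  obtain ⟨m, hm, hLm⟩ := Ideal.exists_le_maximal L hL
  obtain ⟨y, hy, hym⟩ := apd_quot_key hR L (fun h => hI (le_bot_iff.1 (h ▸ hIL))) m hLm
  let w : (R ⧸ I) ⧸ A := A.mkQ (I.mkQ y)
  have htor := apd_torsionOf m w
    (by
      simp only [w]
      rw [Ne, Submodule.mkQ_apply A, Submodule.Quotient.mk_eq_zero]; exact hy)
    (fun t ht => by
      simp only [w]
      rw [← map_smul, ← map_smul, Submodule.mkQ_apply A, Submodule.Quotient.mk_eq_zero]
      exact hym t ht)
  have e := Ideal.quotTorsionOfEquivSpanSingleton R _ w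
  rw [htor] at e
  let C := Submodule.span R {w}
  have hC : Function.Injective (i.rTensor C) :=
    apd_T_sub i e.symm.toLinearMap e.symm.injective (hsimple m hm)
  let B : Submodule R (R ⧸ I) := C.comap A.mkQ
  have hAB : A ≤ B := by
    intro x hx
    change A.mkQ x ∈ C
    rw [Submodule.mkQ_apply, (Submodule.Quotient.mk_eq_zero A).2 hx]
    exact zero_mem _
  have hB : Function.Injective (i.rTensor B) := by
    refine apd_T_ext i (Submodule.inclusion hAB)
      (LinearMap.codRestrict C (A.mkQ ∘ₗ B.subtype) (fun b => b.2))
      (Submodule.inclusion_injective _) ?_ hAT hC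
    intro b
    rw [Subtype.ext_iff]
    change A.mkQ b.1 = 0 ↔ _
    rw [Submodule.mkQ_apply, Submodule.Quotient.mk_eq_zero]
    constructor
    · intro h; exact ⟨⟨b.1, h⟩, rfl⟩
    · rintro ⟨a, rfl⟩; exact a.2
  have hBA : B ≤ A := hA.le_of_ge hB hAB
  exact hy (hBA (show A.mkQ (I.mkQ y) ∈ C from Submodule.mem_span_singleton_self w))

end TorVanishing

theorem apd_step (R : Type u) [CommRing R] [IsDomain R]
    (hR : IsAPD R) (hQ : ¬ IsField R) (K : ModuleCat.{u} R) (h : FlatDimLE R 1 K)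
    (htf : ∀ (r : R) (k : K), r ≠ 0 → r • k = 0 → k = 0) : Module.Flat R K := by
  obtain ⟨P, f, hf, hP, hk⟩ := h
  have hk' : Module.Flat R (kernel f : ModuleCat.{u} R) := hk
  refine apd_flat_of_torsionFree hR hQ (kernel.ι f).hom f.hom
    ((ModuleCat.mono_iff_injective _).1 inferInstance) ((ModuleCat.epi_iff_surjective _).1 hf)
    ?_ htf
  have := (ShortComplex.exact_kernel f)
  exact (ShortComplex.ShortExact.moduleCat_exact_iff_function_exact _).1 this

/-- Over an almost perfect domain that is not a field, any module of finite flat (weak)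
dimension has flat dimension at most `1`. -/
theorem flatDimLE_one_of_finite (R : Type u) [CommRing R] [IsDomain R]
    (hR : IsAPD R) (hQ : ¬ IsField R) (M : ModuleCat.{u} R)
    (h : ∃ n : ℕ, FlatDimLE R n M) : FlatDimLE R 1 M := by
  obtain ⟨n, h⟩ := h
  induction n generalizing M with
  | zero =>
    refine ⟨M, 𝟙 M, inferInstance, h, ?_⟩
    have hz : IsZero (kernel (𝟙 M)) := isZero_kernel_of_mono (𝟙 M)
    have : Subsingleton (kernel (𝟙 M) : ModuleCat.{u} R) := ModuleCat.subsingleton_of_isZero hz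
    exact (inferInstance : Module.Flat R (kernel (𝟙 M) : ModuleCat.{u} R))
  | succ n ih =>
    obtain ⟨P, f, hf, hP, hk⟩ := h
    refine ⟨P, f, hf, hP, apd_step R hR hQ _ (ih _ hk) ?_⟩
    intro r k hr hrk
    have hinj : Function.Injective (kernel.ι f).hom :=
      (ModuleCat.mono_iff_injective _).1 inferInstance
    apply hinj
    have h2 : r • (kernel.ι f).hom k = 0 := by rw [← map_smul, hrk, map_zero]
    rw [map_zero]
    exact (smul_eq_zero.1 h2).resolve_left hr
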